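/- There exists N such that for every integer n ≥ N with n ≡ 3, 5, 24, or 26 (mod 28), the number NC(6n+3, 3) of isomorphism classes of cyclic Steiner triple systems of order 6n+3 satisfies NC(6n+3, 3) ≥ 3.35^n. -/

import Mathlib

namespace CCS

/-- A block: a set of edges of the complete graph on `ZMod v`. -/
abbrev Block (v : ℕ) := Finset (Sym2 (ZMod v))

/-- The edge set of the closed tuple `c = (c 0, c 1, …, c (k-1))`. -/
def edgesOf {v k : ℕ} (c : Fin k → ZMod v) : Block v :=
  Finset.image (fun i : Fin k => s(c i, c ⟨(i.1 + 1) % k, Nat.mod_lt _ i.pos⟩)) Finset.univ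

/-- `E` is the edge set of a `k`-cycle on `ZMod v`. Since for `k ≥ 3` the edge set
determines the closed tuple up to rotation and reversal, a `k`-cycle is identified
with its edge set. -/
def IsCycleBlock (v k : ℕ) (E : Block v) : Prop :=
  ∃ c : Fin k → ZMod v, Function.Injective c ∧ E = edgesOf c

/-- The translate `E + z` of a cycle. -/
def translateBlock {v : ℕ} (E : Block v) (z : ZMod v) : Block v :=
  E.image (Sym2.map (· + z))

/-- A `(K_v, C_k)`-design: a set of `k`-cycles whose edge sets partition the edges of `K_v`. -/
def IsDesign (v k : ℕ) (B : Set (Block v)) : Prop :=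
  (∀ E ∈ B, IsCycleBlock v k E) ∧
  ∀ e : Sym2 (ZMod v), ¬ e.IsDiag → ∃! E, E ∈ B ∧ e ∈ E

/-- A cyclic `(K_v, C_k)`-design. -/
def IsCyclicDesign (v k : ℕ) (B : Set (Block v)) : Prop :=
  IsDesign v k B ∧ ∀ E ∈ B, ∀ z : ZMod v, translateBlock E z ∈ B

/-- Two designs are isomorphic if a bijection of `ZMod v` maps one onto the other. -/
def Isomorphic {v : ℕ} (B B' : Set (Block v)) : Prop :=
  ∃ f : ZMod v ≃ ZMod v, B' = (fun E : Block v => E.image (Sym2.map f)) '' B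

/-- `NC v k`: the number of cyclic `(K_v, C_k)`-designs up to isomorphism. -/
noncomputable def NC (v k : ℕ) : ℕ :=
  Nat.card (Quot fun B B' : {B : Set (Block v) // IsCyclicDesign v k B} =>
    Isomorphic B.1 B'.1)

/-- The type of a cycle: the order of its stabilizer under translations. -/
noncomputable def cycleType {v : ℕ} (E : Block v) : ℕ :=
  Nat.card {z : ZMod v // translateBlock E z = E}

/-- The two differences `±(a-b)` arising from an edge `{a,b}`. -/
def edgeDiffs {v : ℕ} : Sym2 (ZMod v) → Multiset (ZMod v) :=
  Sym2.lift ⟨fun a b => {a - b, b - a}, fun a b => by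
    show (a-b) ::ₘ {b-a} = (b-a) ::ₘ {a-b}; exact Multiset.cons_swap _ _ _⟩

/-- The multiset of the `2k` differences arising from the `k` edges of a cycle.
For a cycle of type `d` this is `d` copies of the list `∂C` of partial differences. -/
def fullDiffs {v : ℕ} (E : Block v) : Multiset (ZMod v) :=
  E.val.bind edgeDiffs

/-- The multiset `∂C` of partial differences of a cycle: each difference is counted
with multiplicity equal to its multiplicity among the `2k` edge differences divided
by the type of the cycle. -/
noncomputable def partialDiffs {v : ℕ} (E : Block v) : Multiset (ZMod v) :=
  (fullDiffs E).toFinset.val.bind fun x =>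
    Multiset.replicate ((fullDiffs E).count x / cycleType E) x

/-- A `(K_v, C_k)`-difference system: a set of `k`-cycles whose partial differences
cover every nonzero element of `ZMod v` exactly once. -/
def IsDifferenceSystem (v k : ℕ) (F : Finset (Block v)) : Prop :=
  (∀ E ∈ F, IsCycleBlock v k E) ∧
  ∀ x : ZMod v, (F.val.bind partialDiffs).count x = if x = 0 then 0 else 1

end CCS

namespace CCS

section Triangles

variable {v : ℕ}

/-- The edge set of the triangle on `a, b, c`. -/
def tri (a b c : ZMod v) : Block v := {s(a, b), s(b, c), s(c, a)}

theorem edgesOf_eq_tri (c : Fin 3 → ZMod v) : edgesOf c = tri (c 0) (c 1) (c 2) := by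
  ext e
  simp only [edgesOf, tri, Finset.mem_image, Finset.mem_univ, true_and, Fin.exists_fin_succ,
    Finset.mem_insert, Finset.mem_singleton, IsEmpty.exists_iff, or_false]
  simp [eq_comm (a := e)]

theorem mem_tri {a b c : ZMod v} {e : Sym2 (ZMod v)} :
    e ∈ tri a b c ↔ e = s(a, b) ∨ e = s(b, c) ∨ e = s(c, a) := by
  simp [tri]

theorem tri_rotate (a b c : ZMod v) : tri a b c = tri b c a := by
  ext e; simp only [mem_tri]; tauto

theorem tri_swap (a b c : ZMod v) : tri a b c = tri b a c := by
  ext e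
  simp only [mem_tri, Sym2.eq_swap (a := a) (b := b), Sym2.eq_swap (a := c) (b := b),
    Sym2.eq_swap (a := c) (b := a)]
  tauto

theorem tri_right_cancel {a b c c' : ZMod v} (hca : c ≠ a) (hcb : c ≠ b)
    (h : tri a b c = tri a b c') : c = c' := by
  have h1 : s(b, c) ∈ tri a b c' := h ▸ mem_tri.2 (.inr (.inl rfl))
  simp only [mem_tri, Sym2.eq_iff] at h1
  grind

theorem image_tri (f : ZMod v → ZMod v) (a b c : ZMod v) :
    (tri a b c).image (Sym2.map f) = tri (f a) (f b) (f c) := by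
  simp [tri, Finset.image_insert]

/-- The third-point function of a cyclic Steiner triple system: `T d` is the point completing
the pair `0, d` to a block. -/
structure IsThirdPoint (T : ZMod v → ZMod v) : Prop where
  ne_zero : ∀ d, d ≠ 0 → T d ≠ 0
  ne_self : ∀ d, d ≠ 0 → T d ≠ d
  invol : ∀ d, d ≠ 0 → T (T d) = d
  neg : ∀ d, d ≠ 0 → T (-d) = T d - d

/-- The blocks of the cyclic Steiner triple system with third-point function `T`. -/
def thirdPointDesign (T : ZMod v → ZMod v) : Set (Block v) :=
  {E | ∃ p d, d ≠ 0 ∧ E = tri p (p + d) (p + T d)}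

variable {T : ZMod v → ZMod v}

theorem tri_mem_thirdPointDesign (T : ZMod v → ZMod v) {a b : ZMod v} (h : a ≠ b) :
    tri a b (a + T (b - a)) ∈ thirdPointDesign T :=
  ⟨a, b - a, sub_ne_zero.2 h.symm, by simp⟩

theorem IsThirdPoint.eq_tri_of_mem (hT : IsThirdPoint T) {E : Block v}
    (hE : E ∈ thirdPointDesign T) {a b : ZMod v} (hab : s(a, b) ∈ E) :
    E = tri a b (a + T (b - a)) := by
  obtain ⟨p, d, hd, rfl⟩ := hE
  have hTd := hT.ne_zero d hd
  have h2 : T (d - T d) = -T d := by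
    have := hT.neg (T d) hTd
    rw [hT.invol d hd] at this
    have h3 := hT.invol (-T d) (neg_ne_zero.2 hTd)
    rwa [this] at h3
  have h3 : T (T d - d) = -d := by
    rw [← hT.neg d hd, hT.invol (-d) (neg_ne_zero.2 hd)]
  have h4 := hT.neg d hd
  have h5 := hT.neg (T d) hTd
  have h6 := hT.invol d hd
  rw [h6] at h5
  simp only [mem_tri, Sym2.eq_iff] at hab
  rcases hab with (⟨rfl, rfl⟩ | ⟨rfl, rfl⟩) | (⟨rfl, rfl⟩ | ⟨rfl, rfl⟩) | (⟨rfl, rfl⟩ | ⟨rfl, rfl⟩)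
  · simp
  · rw [tri_swap, show b - (b + d) = -d by ring, h4]
    congr 1; ring
  · rw [tri_rotate, show p + T d - (p + d) = T d - d by ring, h3]
    congr 1; ring
  · rw [tri_rotate, tri_swap, show p + d - (p + T d) = d - T d by ring, h2]
    congr 1; ring
  · rw [tri_rotate, tri_rotate, show b - (b + T d) = -T d by ring, h5]
    congr 1; ring
  · rw [tri_swap, tri_rotate, show a + T d - a = T d by ring, h6]

theorem IsThirdPoint.isCyclicDesign (hT : IsThirdPoint T) :
    IsCyclicDesign v 3 (thirdPointDesign T) := by
  refine ⟨⟨?_, ?_⟩, ?_⟩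
  · rintro _ ⟨p, d, hd, rfl⟩
    refine ⟨![p, p + d, p + T d], ?_, by rw [edgesOf_eq_tri]; rfl⟩
    have h1 := hT.ne_zero d hd
    have h2 := hT.ne_self d hd
    intro i j hij
    fin_cases i <;> fin_cases j <;> simp_all [eq_comm]
  · intro e
    induction e with | h a b => ?_
    intro hab
    rw [Sym2.mk_isDiag_iff] at hab
    exact ⟨_, ⟨tri_mem_thirdPointDesign T hab, mem_tri.2 (.inl rfl)⟩,
      fun E hE => hT.eq_tri_of_mem hE.1 hE.2⟩
  · rintro _ ⟨p, d, hd, rfl⟩ z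
    refine ⟨p + z, d, hd, ?_⟩
    rw [translateBlock, image_tri]
    congr 1 <;> ring

theorem IsDesign.eq_of_mem {k : ℕ} {B : Set (Block v)} (hB : IsDesign v k B) {E E' : Block v}
    (hE : E ∈ B) (hE' : E' ∈ B) {a b : ZMod v} (hab : a ≠ b) (h : s(a, b) ∈ E)
    (h' : s(a, b) ∈ E') : E = E' :=
  (hB.2 s(a, b) (by simpa using hab)).unique ⟨hE, h⟩ ⟨hE', h'⟩

theorem IsThirdPoint.eq_of_thirdPointDesign_eq {T' : ZMod v → ZMod v} (hT : IsThirdPoint T)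
    (hT' : IsThirdPoint T') (h : thirdPointDesign T = thirdPointDesign T') {d : ZMod v}
    (hd : d ≠ 0) : T d = T' d := by
  have h1 := tri_mem_thirdPointDesign T hd.symm
  rw [h] at h1
  have h2 := hT'.eq_tri_of_mem h1 (a := 0) (b := d) (mem_tri.2 (.inl rfl))
  simp only [sub_zero, zero_add] at h2
  exact tri_right_cancel (hT.ne_zero d hd) (hT.ne_self d hd) h2

theorem Isomorphic.equivalence :
    Equivalence fun B B' : {B : Set (Block v) // IsCyclicDesign v 3 B} =>
      Isomorphic B.1 B'.1 := by
  refine ⟨fun B => ⟨Equiv.refl _, ?_⟩, ?_, ?_⟩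
  · simp
  · rintro B B' ⟨f, hf⟩
    refine ⟨f.symm, ?_⟩
    rw [hf, Set.image_image]
    simp [Finset.image_image, ← Sym2.map_comp]
  · rintro B B' B'' ⟨f, hf⟩ ⟨g, hg⟩
    refine ⟨f.trans g, ?_⟩
    rw [hg, hf, Set.image_image]
    simp [Finset.image_image, ← Sym2.map_comp]

/-- An isomorphism out of a cyclic system containing the block `{0, 1, 3}` is determined by the
images of `0`, `1`, `2`. -/
theorem eq_of_agree [NeZero v] {T T' : ZMod v → ZMod v} (hT : T 1 = 3) (hT' : T' 1 = 3)
    (h1 : (1 : ZMod v) ≠ 0) (h2 : (2 : ZMod v) ≠ 0) (h3 : (3 : ZMod v) ≠ 0)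
    {B : Set (Block v)} (hB : IsDesign v 3 B) (f g : ZMod v ≃ ZMod v)
    (hf : B = (fun E : Block v => E.image (Sym2.map f)) '' thirdPointDesign T)
    (hg : B = (fun E : Block v => E.image (Sym2.map g)) '' thirdPointDesign T')
    (e0 : f 0 = g 0) (e1 : f 1 = g 1) (e2 : f 2 = g 2) : f = g := by
  have key : ∀ i : ℕ, f i = g i := by
    intro i
    induction i using Nat.strong_induction_on with
    | _ i ih =>
      match i with
      | 0 => simpa using e0
      | 1 => simpa using e1
      | 2 => simpa using e2
      | i + 3 =>
        have a0 := ih i (by omega)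
        have a1 := ih (i + 1) (by omega)
        have mf : tri (f i) (f (i + 1 : ℕ)) (f (i + 3 : ℕ)) ∈ B := by
          rw [hf]
          refine ⟨_, ⟨(i : ZMod v), 1, h1, rfl⟩, ?_⟩
          simp [image_tri, hT]
        have mg : tri (g i) (g (i + 1 : ℕ)) (g (i + 3 : ℕ)) ∈ B := by
          rw [hg]
          refine ⟨_, ⟨(i : ZMod v), 1, h1, rfl⟩, ?_⟩
          simp [image_tri, hT']
        rw [← a0, ← a1] at mg
        have hne : f i ≠ f (i + 1 : ℕ) := by
          intro h
          have := f.injective h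
          push_cast at this
          exact h1 (by linear_combination -this)
        have := hB.eq_of_mem mf mg hne (mem_tri.2 (.inl rfl)) (mem_tri.2 (.inl rfl))
        refine tri_right_cancel ?_ ?_ this
        · intro h
          have := f.injective h
          simp [h3] at this
        · intro h
          have := f.injective h
          apply h2
          push_cast at this
          linear_combination this
  ext1 x
  rw [← ZMod.natCast_zmod_val x, key]

theorem card_le_NC [NeZero v] (h1 : (1 : ZMod v) ≠ 0) (h2 : (2 : ZMod v) ≠ 0)
    (h3 : (3 : ZMod v) ≠ 0) {α : Type*} [Fintype α] (T : α → ZMod v → ZMod v)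
    (hT : ∀ x, IsThirdPoint (T x)) (hT1 : ∀ x, T x 1 = 3)
    (hinj : ∀ x y, (∀ d, d ≠ 0 → T x d = T y d) → x = y) :
    Fintype.card α ≤ NC v 3 * v ^ 3 := by
  classical
  let r := fun B B' : {B : Set (Block v) // IsCyclicDesign v 3 B} => Isomorphic B.1 B'.1
  let q : α → Quot r := fun x => Quot.mk r ⟨thirdPointDesign (T x), (hT x).isCyclicDesign⟩
  have hiso : ∀ x, Isomorphic (thirdPointDesign (T x)) (q x).out.1 := by
    intro x
    have h : Quot.mk r (q x).out = q x := Quot.out_eq _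
    have h' := Quot.eqvGen_exact h
    rw [Isomorphic.equivalence.eqvGen_iff] at h'
    exact Isomorphic.equivalence.symm h'
  choose f hf using hiso
  have : Finite (Quot r) := inferInstance
  let Φ : α → Quot r × (Fin 3 → ZMod v) := fun x => (q x, ![f x 0, f x 1, f x 2])
  have hΦ : Function.Injective Φ := by
    intro x y hxy
    have hq : q x = q y := congrArg Prod.fst hxy
    have h012 := congrArg Prod.snd hxy
    have e0 : f x 0 = f y 0 := congrFun h012 0
    have e1 : f x 1 = f y 1 := congrFun h012 1
    have e2 : f x 2 = f y 2 := congrFun h012 2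
    have hy := hf y
    rw [← hq] at hy
    have hfg := eq_of_agree (hT1 x) (hT1 y) h1 h2 h3 (q x).out.2.1 (f x) (f y) (hf x) hy e0 e1 e2
    apply hinj
    intro d hd
    refine (hT x).eq_of_thirdPointDesign_eq (hT y) ?_ hd
    have hx := hf x
    rw [hy, hfg] at hx
    exact ((Finset.image_injective (Sym2.map.injective (f y).injective)).image_injective hx).symm
  have := Nat.card_le_card_of_injective Φ hΦ
  rw [Nat.card_prod, Nat.card_eq_fintype_card, Nat.card_fun, Nat.card_zmod] at this
  simpa [NC, r] using this

end Triangles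

section Triples

/-- A family of triples in an abelian group whose entries are distinct up to sign. -/
def SignInj {G ι : Type*} [Neg G] (X : ι → Fin 3 → G) : Prop :=
  ∀ i r j s, X i r = X j s ∨ X i r = -X j s → i = j ∧ r = s

/-- A difference family of zero-sum triples yields a third-point function. -/
theorem exists_isThirdPoint {v : ℕ} {κ : Type*} (X : κ → Fin 3 → ZMod v)
    (hsum : ∀ i, X i 0 + X i 1 + X i 2 = 0)
    (hinj : ∀ i r j s, X i r = X j s → X i (r - 1) = X j (s - 1))
    (hneg : ∀ i r j s, X i r ≠ -X j s)
    (hcov : ∀ d, d ≠ 0 → ∃ i r, d = X i r ∨ d = -X i r) :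
    ∃ T : ZMod v → ZMod v, IsThirdPoint T ∧ (∀ i r, T (X i r) = -X i (r - 1)) ∧
      ∀ i r, T (-X i r) = X i (r + 1) := by
  classical
  have hs : ∀ i r, X i (r + 1) = -X i r - X i (r - 1) := by
    intro i r
    have h := hsum i
    fin_cases r
    · change X i 1 = -X i 0 - X i 2
      linear_combination h
    · change X i 2 = -X i 1 - X i 0
      linear_combination h
    · change X i 0 = -X i 2 - X i 1
      linear_combination h
  let T : ZMod v → ZMod v := fun d =>
    if h : ∃ p : κ × Fin 3, d = X p.1 p.2 then -X h.choose.1 (h.choose.2 - 1)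
    else if h : ∃ p : κ × Fin 3, d = -X p.1 p.2 then X h.choose.1 (h.choose.2 + 1) else 0
  have hpos : ∀ i r, T (X i r) = -X i (r - 1) := by
    intro i r
    have h : ∃ p : κ × Fin 3, X i r = X p.1 p.2 := ⟨(i, r), rfl⟩
    simp only [T, dif_pos h]
    rw [hinj _ _ _ _ h.choose_spec]
  have hng : ∀ i r, T (-X i r) = X i (r + 1) := by
    intro i r
    have h : ∃ p : κ × Fin 3, -X i r = -X p.1 p.2 := ⟨(i, r), rfl⟩
    have h' : ¬ ∃ p : κ × Fin 3, -X i r = X p.1 p.2 := by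
      rintro ⟨p, hp⟩
      exact hneg p.1 p.2 i r hp.symm
    simp only [T, dif_pos h, dif_neg h']
    have h1 := neg_injective h.choose_spec
    rw [hs, hs, ← h1, hinj _ _ _ _ h1]
  have hnz : ∀ i r, X i r ≠ 0 := fun i r h => hneg i r i r (by rw [h, neg_zero])
  refine ⟨T, ⟨?_, ?_, ?_, ?_⟩, hpos, hng⟩ <;> intro d hd <;> obtain ⟨i, r, rfl | rfl⟩ := hcov d hd
  · rw [hpos]
    exact neg_ne_zero.2 (hnz _ _)
  · rw [hng]
    exact hnz _ _
  · rw [hpos]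
    exact (hneg _ _ _ _).symm
  · rw [hng]
    exact hneg _ _ _ _
  · rw [hpos, hng, sub_add_cancel]
  · rw [hng, hpos, add_sub_cancel_right]
  · rw [hng, hpos, hs]
    ring
  · rw [neg_neg, hpos, hng, hs]
    ring

end Triples

section Model

/-- The projection `(x, c) ↦ x + c (2n+1)` onto `ZMod (6n+3)`. -/
def proj (n : ℕ) : ℤ × ZMod 3 →+ ZMod (6 * n + 3) :=
  (Int.castAddHom _).coprod
    (ZMod.lift 3 ⟨(Int.castAddHom (ZMod (6 * n + 3))).comp (AddMonoidHom.mulLeft (2 * n + 1 : ℤ)), by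
      simp only [AddMonoidHom.coe_comp, Function.comp_apply, AddMonoidHom.coe_mulLeft,
        Int.coe_castAddHom]
      rw [ZMod.intCast_zmod_eq_zero_iff_dvd]
      exact ⟨1, by push_cast; ring⟩⟩)

theorem proj_apply (n : ℕ) (x c : ℤ) :
    proj n (x, (c : ZMod 3)) = ((x + (2 * n + 1) * c : ℤ) : ZMod (6 * n + 3)) := by
  simp [proj]

theorem proj_inj {n : ℕ} {g h : ℤ × ZMod 3} (hg : |g.1| ≤ n) (hh : |h.1| ≤ n)
    (e : proj n g = proj n h) : g = h := by
  obtain ⟨x, c⟩ := g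
  obtain ⟨y, d⟩ := h
  obtain ⟨c, rfl⟩ := ZMod.intCast_surjective c
  obtain ⟨d, rfl⟩ := ZMod.intCast_surjective d
  rw [proj_apply, proj_apply, ZMod.intCast_eq_intCast_iff_dvd_sub] at e
  obtain ⟨k, hk⟩ := e
  push_cast at hk
  rw [abs_le] at hg hh
  have hxy : y - x = (2 * n + 1) * (3 * k - d + c) := by linear_combination hk
  have h0 : 3 * k - d + c = 0 := by
    have h1 : 3 * k - d + c < 1 := by
      by_contra! h
      nlinarith
    have h2 : -1 < 3 * k - d + c := by
      by_contra! h
      nlinarith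
    omega
  rw [h0, mul_zero] at hxy
  refine Prod.ext (by simpa using (sub_eq_zero.1 hxy).symm) ?_
  rw [ZMod.intCast_eq_intCast_iff_dvd_sub]
  exact ⟨k, by push_cast; linarith⟩

theorem proj_wrap (n : ℕ) (τ : ℤ) :
    proj n (τ * (2 * n + 1), -(τ : ZMod 3)) = 0 := by
  have := proj_apply n (τ * (2 * n + 1)) (-τ)
  push_cast at this
  rw [this]
  ring

/-- Zero-sum triples covering all `(x, c)` with `0 < |x| ≤ n` up to sign give a
third-point function on `ZMod (6n+3)`. -/
theorem exists_isThirdPoint_of_signInj {n : ℕ} {ι : Type*} [Fintype ι]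
    (hcard : Fintype.card ι = n) (X : ι → Fin 3 → ℤ × ZMod 3) (hX : SignInj X)
    (hpos : ∀ i r, 0 < |(X i r).1|) (hle : ∀ i r, |(X i r).1| ≤ n)
    (hsum : ∀ i, proj n (X i 0 + X i 1 + X i 2) = 0) :
    ∃ T : ZMod (6 * n + 3) → ZMod (6 * n + 3), IsThirdPoint T ∧
      (∀ i r, T (proj n (X i r)) = proj n (-X i (r - 1))) ∧
      ∀ i r, T (proj n (-X i r)) = proj n (X i (r + 1)) := by
  classical
  let Y : Option ι → Fin 3 → ℤ × ZMod 3 := fun i r => i.elim (0, 1) (X · r)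
  have hYle : ∀ i r, |(Y i r).1| ≤ n := by
    rintro (_ | i) r
    · simp [Y]
    · exact hle i r
  have hYne : ∀ i r j s, Y i r ≠ -Y j s := by
    rintro (_ | i) r (_ | j) s h
    · have h1 : (1 : ZMod 3) = -1 := congrArg Prod.snd h
      exact absurd h1 (by decide)
    · have h1 := hpos j s
      have h2 : (0 : ℤ) = -(X j s).1 := congrArg Prod.fst h
      rw [abs_pos] at h1
      omega
    · have h1 := hpos i r
      have h2 : (X i r).1 = -0 := congrArg Prod.fst h
      rw [abs_pos] at h1
      omega
    · obtain ⟨rfl, rfl⟩ := hX i r j s (.inr h)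
      have h1 := hpos i r
      have h2 : (X i r).1 = -(X i r).1 := congrArg Prod.fst h
      rw [abs_pos] at h1
      omega
  suffices h : ∃ T : ZMod (6 * n + 3) → ZMod (6 * n + 3), IsThirdPoint T ∧
      (∀ i r, T (proj n (Y i r)) = -proj n (Y i (r - 1))) ∧
      ∀ i r, T (-proj n (Y i r)) = proj n (Y i (r + 1)) by
    obtain ⟨T, hT, h1, h2⟩ := h
    refine ⟨T, hT, fun i r => ?_, fun i r => ?_⟩
    · rw [map_neg]
      exact h1 (some i) r
    · rw [map_neg]
      exact h2 (some i) r
  refine exists_isThirdPoint (fun i r => proj n (Y i r)) ?_ ?_ ?_ ?_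
  · rintro (_ | i)
    · change proj n (0, 1) + proj n (0, 1) + proj n (0, 1) = 0
      rw [← map_add, ← map_add]
      exact map_zero (proj n)
    · have := hsum i
      rw [map_add, map_add] at this
      exact this
  · intro i r j s h
    have h := proj_inj (hYle i r) (hYle j s) h
    congr 1
    rcases i with _ | i <;> rcases j with _ | j
    · rfl
    · have h1 := hpos j s
      have h2 : (0 : ℤ) = (X j s).1 := congrArg Prod.fst h
      rw [abs_pos] at h1
      omega
    · have h1 := hpos i r
      have h2 : (X i r).1 = 0 := congrArg Prod.fst h
      rw [abs_pos] at h1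
      omega
    · obtain ⟨rfl, rfl⟩ := hX i r j s (.inl h)
      rfl
  · intro i r j s h
    rw [← map_neg] at h
    exact hYne i r j s (proj_inj (hYle i r) (by simpa using hYle j s) h)
  · let F : (ι × Fin 3) ⊕ (ι × Fin 3) ⊕ ZMod 3 → ℤ × ZMod 3 :=
      Sum.elim (fun p => X p.1 p.2) (Sum.elim (fun p => -X p.1 p.2) (fun c => (0, c)))
    have hFle : ∀ q, |(F q).1| ≤ n := by
      rintro (⟨i, r⟩ | ⟨i, r⟩ | c)
      · exact hle i r
      · simpa [F] using hle i r
      · simp [F]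
    have hF : Function.Injective F := by
      have e0 : ∀ i r c, X i r ≠ (0, c) := by
        intro i r c h
        have := hpos i r
        rw [h] at this
        simp at this
      have e0' : ∀ i r c, -X i r ≠ (0, c) := by
        intro i r c h
        exact e0 i r (-c) (by rw [← neg_neg (X i r), h]; simp)
      rintro (⟨i, r⟩ | ⟨i, r⟩ | c) (⟨j, s⟩ | ⟨j, s⟩ | d) h
      · obtain ⟨rfl, rfl⟩ := hX i r j s (.inl h)
        rfl
      · exact absurd h (hYne (some i) r (some j) s)
      · exact absurd h (e0 _ _ _)
      · exact absurd h.symm (hYne (some j) s (some i) r)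
      · obtain ⟨rfl, rfl⟩ := hX i r j s (.inl (neg_injective h))
        rfl
      · exact absurd h (e0' _ _ _)
      · exact absurd h.symm (e0 _ _ _)
      · exact absurd h.symm (e0' _ _ _)
      · rw [show c = d from congrArg Prod.snd h]
    have hb : Function.Bijective (proj n ∘ F) := by
      rw [Fintype.bijective_iff_injective_and_card]
      refine ⟨fun p q h => hF (proj_inj (hFle p) (hFle q) h), ?_⟩
      simp only [Fintype.card_sum, Fintype.card_prod, hcard, Fintype.card_fin, ZMod.card]
      ring
    intro d hd
    obtain ⟨⟨i, r⟩ | ⟨i, r⟩ | c, rfl⟩ := hb.2 d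
    · exact ⟨some i, r, .inl rfl⟩
    · exact ⟨some i, r, .inr (map_neg _ _)⟩
    · have h3 : ∀ c : ZMod 3, c = 0 ∨ c = 1 ∨ c = -1 := by decide
      rcases h3 c with rfl | rfl | rfl
      · exact absurd (map_zero _) hd
      · exact ⟨none, 0, .inl rfl⟩
      · refine ⟨none, 0, .inr ?_⟩
        rw [← map_neg]
        rfl

end Model

section Arrays

/-- Permutations `π` of `0, …, 8`, written as decimal numbers with `o`-th digit `π o`, for which
`o ↦ 12 - o - π o` is again a permutation of `0, …, 8`. -/
def codes : List ℕ :=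
  [21687354, 21687435, 21768354, 21768435, 24718536, 25187364, 25713864, 25714836, 25731846,
   26174835, 31682754, 31758246, 35182764, 35281746, 36172584, 36174285, 36218754, 36271485,
   41582736, 41726835, 41752836, 41763285, 43187265, 43721865, 46137285, 51472836, 51627384,
   53172864, 53271846, 54218736, 102687354, 102687435, 102768354, 102768435, 104683275,
   104728635, 105387246, 105742836, 106372854, 106528374, 130682574, 130684275, 130748265,
   132708465, 132708546, 135084276, 136028574, 136208475, 140287635, 140387265, 142087536,
   142703865, 146203875, 150268374, 150372864, 150632874, 152073864, 152074836, 154038276,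
   154208376, 203681475, 203718654, 205186374, 205381746, 205481376, 205713684, 206148735,
   206158374, 206175384, 206318754, 206371485, 210684735, 210758364, 213708465, 213708546,
   215083764, 215084736, 216038754, 216073584, 240381765, 240731685, 241085736, 241703685,
   250318764, 251048736, 251073684, 251308746, 302581746, 302716854, 302751846, 302761485,
   304186275, 304721685, 306147285, 306152874, 306421875, 310487265, 310582764, 310752864,
   310762584, 310764285, 316027584, 316207485, 320715864, 320741865, 321087654, 321705846,
   326104875, 350216874, 350217684, 351026874, 351027684, 402168735, 402176835, 402518736,
   403168275, 403518276, 403621875, 410268735, 410276835, 410637285, 420371865, 420631875,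
   421075836, 421603875, 430271685, 431058276, 432108765]

/-- A zero-sum array whose columns are permutations of `-4, …, 4`. -/
def arr (k : Fin 128) (o : Fin 9) : Fin 3 → ℤ :=
  ![o - 4, (codes[k]?.getD 0 / 10 ^ (o : ℕ) % 10 : ℕ) - 4,
    8 - o - (codes[k]?.getD 0 / 10 ^ (o : ℕ) % 10 : ℕ)]

theorem arr_sum (k : Fin 128) (o : Fin 9) : arr k o 0 + arr k o 1 + arr k o 2 = 0 := by
  simp only [arr, Matrix.cons_val]
  ring

theorem codes_good : ∀ x ∈ codes, x < 10 ^ 9 ∧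
    ((List.range 9).map fun o => x / 10 ^ o % 10).Nodup ∧
    ((List.range 9).map fun o => o + x / 10 ^ o % 10).Nodup ∧
    ∀ o ∈ List.range 9, x / 10 ^ o % 10 ≤ 8 ∧ 4 ≤ o + x / 10 ^ o % 10 ∧ o + x / 10 ^ o % 10 ≤ 12 := by
  decide +kernel

theorem codes_pairwise : codes.Pairwise (· < ·) := by
  rw [← List.isChain_iff_pairwise]
  decide +kernel

theorem codes_getD_mem (k : Fin 128) : codes[k]?.getD 0 ∈ codes := by
  have hk : (k : ℕ) < codes.length := k.2
  simp [hk]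

theorem arr_le (k : Fin 128) (o : Fin 9) (r : Fin 3) : -4 ≤ arr k o r ∧ arr k o r ≤ 4 := by
  have h := (codes_good _ (codes_getD_mem k)).2.2.2 o (List.mem_range.2 o.2)
  have := o.2
  fin_cases r <;> simp only [arr, Matrix.cons_val, Fin.zero_eta, Fin.mk_one, Fin.reduceFinMk] <;>
    omega

theorem arr_inj (k : Fin 128) (r : Fin 3) {o o' : Fin 9} (h : arr k o r = arr k o' r) :
    o = o' := by
  obtain ⟨-, h1, h2, -⟩ := codes_good _ (codes_getD_mem k)
  rw [List.nodup_map_iff_inj_on List.nodup_range] at h1 h2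
  have ho := List.mem_range.2 o.2
  have ho' := List.mem_range.2 o'.2
  apply Fin.ext
  fin_cases r <;>
    simp only [arr, Matrix.cons_val, Fin.zero_eta, Fin.mk_one, Fin.reduceFinMk] at h
  · omega
  · exact h1 _ ho _ ho' (by omega)
  · exact h2 _ ho _ ho' (by omega)

theorem arr_ext {k k' : Fin 128} (h : ∀ o, arr k o 1 = arr k' o 1) : k = k' := by
  have hx := (codes_good _ (codes_getD_mem k)).1
  have hx' := (codes_good _ (codes_getD_mem k')).1
  have hxx : codes[k]?.getD 0 = codes[k']?.getD 0 := by
    simp only [arr, Matrix.cons_val] at h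
    generalize codes[k]?.getD 0 = x at *
    generalize codes[k']?.getD 0 = x' at *
    have h' : ∀ o : Fin 9, x / 10 ^ (o : ℕ) % 10 = x' / 10 ^ (o : ℕ) % 10 := fun o => by
      have := h o
      omega
    have h0 := h' 0
    have h1 := h' 1
    have h2 := h' 2
    have h3 := h' 3
    have h4 := h' 4
    have h5 := h' 5
    have h6 := h' 6
    have h7 := h' 7
    have h8 := h' 8
    simp at h0 h1 h2 h3 h4 h5 h6 h7 h8
    omega
  have hk : (k : ℕ) < codes.length := k.2
  have hk' : (k' : ℕ) < codes.length := k'.2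
  simp only [hk, hk', getElem?_pos, Option.getD_some] at hxx
  have hnd : codes.Nodup := codes_pairwise.imp ne_of_lt
  exact Fin.ext (hnd.getElem_inj_iff.1 hxx)

end Arrays

section Tables

/-- The sign of `w`, replaced by `0` for `|w| ≤ 22`. -/
def farSign (w : ℤ) : ℤ := if 22 < w then 1 else if w < -22 then -1 else 0

/-- The element `(x, c)` with `z = 3 x + c`, `c ∈ {-1, 0, 1}`, moved outwards by `D` if
`|x| > 22`. -/
def elt (D z : ℤ) : ℤ × ZMod 3 := ((z + 1) / 3 + D * farSign ((z + 1) / 3), (z : ZMod 3))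

theorem elt_neg (D z : ℤ) : elt D (-z) = -elt D z := by
  have h : (-z + 1) / 3 = -((z + 1) / 3) := by omega
  have h' : farSign (-((z + 1) / 3)) = -farSign ((z + 1) / 3) := by
    unfold farSign
    split_ifs <;> omega
  refine Prod.ext ?_ (by simp [elt])
  simp only [elt, h, h', Prod.fst_neg]
  ring

theorem elt_inj {D z z' : ℤ} (hD : 0 ≤ D) (h : elt D z = elt D z') : z = z' := by
  have h1 := congrArg Prod.fst h
  have h2 : (z : ZMod 3) = z' := congrArg Prod.snd h
  rw [ZMod.intCast_eq_intCast_iff_dvd_sub] at h2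
  simp only [elt, farSign] at h1
  split_ifs at h1 <;> push_cast at h2 <;> omega

theorem natAbs_eq_of_elt {D z z' : ℤ} (hD : 0 ≤ D) (h : elt D z = elt D z' ∨ elt D z = -elt D z') :
    z.natAbs = z'.natAbs := by
  rw [Int.natAbs_eq_natAbs_iff]
  refine h.imp (elt_inj hD) fun h => elt_inj hD ?_
  rw [h, elt_neg]

/-- A table row is admissible for the range `0 < |x| ≤ n₀` and remains so after moving the outer
elements outwards. -/
def RowGood (n₀ : ℕ) (z : Fin 3 → ℤ) : Prop :=
  (∀ r, ((z r + 1) / 3).natAbs ≠ 0 ∧ ((z r + 1) / 3).natAbs ≤ n₀) ∧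
  ∃ τ ∈ [-1, 0, (1 : ℤ)],
    farSign ((z 0 + 1) / 3) + farSign ((z 1 + 1) / 3) + farSign ((z 2 + 1) / 3) = 2 * τ ∧
    (z 0 + 1) / 3 + (z 1 + 1) / 3 + (z 2 + 1) / 3 = τ * (2 * n₀ + 1) ∧
    3 ∣ z 0 + z 1 + z 2 + τ

instance (n₀ : ℕ) (z : Fin 3 → ℤ) : Decidable (RowGood n₀ z) := by
  unfold RowGood
  infer_instance

/-- The absolute values of the entries of a row. -/
def rowAbs (z : Fin 3 → ℤ) : List ℕ := [(z 0).natAbs, (z 1).natAbs, (z 2).natAbs]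

theorem natAbs_mem_rowAbs (z : Fin 3 → ℤ) (r : Fin 3) : (z r).natAbs ∈ rowAbs z := by
  fin_cases r <;> simp [rowAbs]

theorem entries_inj {L : List (Fin 3 → ℤ)} (hL : (L.flatMap rowAbs).Nodup) {i j : Fin L.length}
    {r s : Fin 3} (h : (L[i] r).natAbs = (L[j] s).natAbs) : i = j ∧ r = s := by
  obtain ⟨h1, h2⟩ := List.nodup_flatMap.1 hL
  have h2 := List.pairwise_iff_getElem.1 h2
  have hi := natAbs_mem_rowAbs L[i] r
  have hj := natAbs_mem_rowAbs L[j] s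
  rcases lt_trichotomy i j with hlt | rfl | hlt
  · exact (h2 i j i.2 j.2 hlt hi (h ▸ hj)).elim
  · have h1 := h1 _ (List.getElem_mem i.2)
    refine ⟨rfl, ?_⟩
    change (rowAbs L[i]).Nodup at h1
    generalize L[i] = z at *
    fin_cases r <;> fin_cases s <;> simp_all [rowAbs]
  · exact (h2 j i j.2 i.2 hlt (h ▸ hj) hi).elim

/-- The entries of the list are distinct and not among the bits set in `mask`. -/
def distinctFrom (mask : ℕ) : List ℕ → Bool
  | [] => true
  | a :: l => !mask.testBit a && distinctFrom (mask ||| 2 ^ a) l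

theorem nodup_of_distinctFrom {l : List ℕ} {mask : ℕ} (h : distinctFrom mask l = true) :
    l.Nodup ∧ ∀ a ∈ l, mask.testBit a = false := by
  induction l generalizing mask with
  | nil => simp
  | cons a l ih =>
    simp only [distinctFrom, Bool.and_eq_true, Bool.not_eq_true'] at h
    obtain ⟨h1, h2⟩ := ih h.2
    simp only [Nat.testBit_or, Bool.or_eq_false_iff] at h2
    refine ⟨List.nodup_cons.2 ⟨fun ha => ?_, h1⟩, ?_⟩
    · simpa using (h2 a ha).2
    · simp only [List.mem_cons, forall_eq_or_imp]
      exact ⟨h.1, fun b hb => (h2 b hb).1⟩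

/-- Row tables with `26 + 2 k` rows, the first row `![3, 6, -9]` omitted. -/
def tables (k : Fin 18) : List (Fin 3 → ℤ) :=
  match k with
  | 0 => [![2, 46, -48], ![4, 41, -45], ![5, 76, 77], ![7, 75, 79], ![8, 70, -78], ![10, 50, -60],
    ![11, 44, -58], ![12, 39, -51], ![13, 71, 74], ![14, 49, -63], ![15, 47, -62], ![16, 72, 73],
    ![17, 32, -52], ![18, 37, -55], ![19, 40, -56], ![20, 38, -61], ![21, 68, 69], ![22, 35, -57],
    ![23, 43, -66], ![24, 30, -54], ![25, 42, -67], ![26, 27, -53], ![28, 34, -59],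
    ![29, 36, -65], ![31, 33, -64]]
  | 1 => [![2, 49, -51], ![4, 82, -83], ![5, 80, 85], ![7, 47, -54], ![8, 52, -60], ![10, 79, 84],
    ![11, 42, -53], ![12, 45, -57], ![13, 40, -50], ![14, 34, -48], ![15, 77, 78], ![16, 43, -56],
    ![17, 44, -64], ![18, 41, -59], ![19, 73, 81], ![20, 46, -66], ![21, 37, -58], ![22, 39, -61],
    ![23, 71, 76], ![24, 72, 74], ![25, 30, -55], ![26, 38, -67], ![27, 35, -62], ![28, 70, 75],
    ![29, 36, -65], ![31, 32, -63], ![33, 68, 69]]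
  | 2 => [![2, 47, -52], ![4, 54, -58], ![5, 55, -60], ![7, 87, 91], ![8, 51, -59], ![10, 46, -53],
    ![11, 85, 86], ![12, 38, -50], ![13, 84, 88], ![14, 75, -89], ![15, 33, -48], ![16, 29, -45],
    ![17, 40, -57], ![18, 44, -62], ![19, 49, -65], ![20, 79, 83], ![21, 42, -63], ![22, 81, 82],
    ![23, 41, -67], ![24, 68, 90], ![25, 77, 80], ![26, 32, -61], ![27, 37, -64], ![28, 31, -56],
    ![30, 36, -66], ![34, 73, 78], ![35, 71, 76], ![39, 69, 74], ![43, 70, 72]]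
  | 3 => [![2, 44, -49], ![4, 42, -46], ![5, 81, -86], ![7, 92, 95], ![8, 53, -64], ![10, 84, -94],
    ![11, 41, -55], ![12, 85, -97], ![13, 78, -91], ![14, 87, 93], ![15, 89, 90], ![16, 80, -96],
    ![17, 47, -67], ![18, 48, -66], ![19, 43, -59], ![20, 25, -45], ![21, 40, -61],
    ![22, 36, -58], ![23, 83, 88], ![24, 32, -56], ![26, 34, -60], ![27, 35, -62], ![28, 29, -57],
    ![30, 33, -63], ![31, 37, -65], ![38, 77, 79], ![39, 76, 82], ![50, 69, 75], ![51, 71, 72],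
    ![52, 68, 74], ![54, 70, 73]]
  | 4 => [![2, 98, -103], ![4, 55, -56], ![5, 96, -101], ![7, 43, -47], ![8, 94, -102], ![10, 99, 100],
    ![11, 53, -67], ![12, 48, -60], ![13, 44, -57], ![14, 25, -39], ![15, 37, -52],
    ![16, 28, -41], ![17, 49, -66], ![18, 93, 95], ![19, 32, -51], ![20, 22, -42], ![21, 33, -54],
    ![23, 86, 97], ![24, 35, -59], ![26, 29, -58], ![27, 89, 90], ![30, 31, -61], ![34, 80, 92],
    ![36, 82, 91], ![38, 81, 87], ![40, 84, 85], ![45, 78, 83], ![46, 75, 88], ![50, 77, 79],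
    ![62, 70, 74], ![63, 71, 72], ![64, 69, 76], ![65, 68, 73]]
  | 5 => [![2, 25, -27], ![4, 28, -29], ![5, 58, -63], ![7, 14, -21], ![8, 53, -64], ![10, 52, -59],
    ![11, 36, -47], ![12, 102, 104], ![13, 95, -108], ![15, 31, -46], ![16, 33, -49],
    ![17, 77, -97], ![18, 48, -66], ![19, 99, 103], ![20, 44, -67], ![22, 35, -57],
    ![23, 73, -96], ![24, 41, -65], ![26, 30, -56], ![32, 79, 107], ![34, 78, 109], ![37, 90, 94],
    ![38, 88, 92], ![39, 76, 106], ![40, 81, 100], ![42, 87, 89], ![43, 74, 101], ![45, 68, 105],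
    ![50, 75, 93], ![51, 69, 98], ![54, 82, 85], ![55, 80, 83], ![60, 70, 91], ![61, 71, 86],
    ![62, 72, 84]]
  | 6 => [![2, 113, 115], ![4, 17, -21], ![5, 77, -85], ![7, 76, -80], ![8, 20, -31], ![10, 19, -26],
    ![11, 51, -62], ![12, 46, -58], ![13, 48, -61], ![14, 91, -105], ![15, 89, -104],
    ![16, 47, -63], ![18, 84, -102], ![22, 33, -55], ![23, 74, -100], ![24, 30, -54],
    ![25, 34, -56], ![27, 32, -59], ![28, 38, -66], ![29, 35, -67], ![36, 72, -108],
    ![37, 95, 98], ![39, 88, 106], ![40, 81, 112], ![41, 93, 96], ![42, 94, 97], ![43, 86, 101],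
    ![44, 87, 99], ![45, 71, 114], ![49, 75, 109], ![50, 69, 111], ![52, 68, 110], ![53, 70, 107],
    ![57, 73, 103], ![60, 78, 92], ![64, 79, 90], ![65, 82, 83]]
  | 7 => [![2, 82, -84], ![4, 88, -89], ![5, 24, -29], ![7, 22, -26], ![8, 113, 121], ![10, 27, -37],
    ![11, 43, -54], ![12, 20, -32], ![13, 25, -35], ![14, 72, -86], ![15, 38, -53],
    ![16, 17, -33], ![18, 23, -41], ![19, 21, -40], ![28, 31, -56], ![30, 34, -64],
    ![36, 90, 116], ![39, 91, 115], ![42, 100, 103], ![44, 94, 104], ![45, 92, 105],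
    ![46, 95, 101], ![47, 76, 119], ![48, 85, 112], ![49, 87, 109], ![50, 93, 99], ![51, 71, 120],
    ![52, 83, 107], ![55, 73, 117], ![57, 75, 110], ![58, 69, 118], ![59, 77, 106],
    ![60, 74, 108], ![61, 70, 114], ![62, 78, 102], ![63, 68, 111], ![65, 79, 98], ![66, 80, 96],
    ![67, 81, 97]]
  | 8 => [![2, 117, -119], ![4, 70, -71], ![5, 75, -80], ![7, 78, -85], ![8, 69, -77], ![10, 87, -97],
    ![11, 115, -126], ![12, 53, -65], ![13, 52, -62], ![14, 37, -51], ![15, 33, -48],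
    ![16, 31, -44], ![17, 30, -47], ![18, 95, -113], ![19, 43, -59], ![20, 34, -54],
    ![21, 35, -56], ![22, 24, -46], ![23, 32, -58], ![25, 82, -104], ![26, 94, -120],
    ![27, 74, -101], ![28, 83, -111], ![29, 81, -110], ![36, 72, -108], ![38, 89, 127],
    ![39, 93, 122], ![40, 98, 116], ![41, 88, 125], ![42, 103, 112], ![45, 76, -121],
    ![49, 90, 118], ![50, 99, 105], ![55, 100, 102], ![57, 91, 109], ![60, 73, 124],
    ![61, 86, 107], ![63, 68, 123], ![64, 79, 114], ![66, 92, 96], ![67, 84, 106]]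
  | 9 => [![2, 117, -119], ![4, 71, -75], ![5, 7, -12], ![8, 74, -85], ![10, 23, -33], ![11, 37, -48],
    ![13, 28, -38], ![14, 31, -45], ![15, 25, -40], ![16, 72, -88], ![17, 27, -44],
    ![18, 32, -50], ![19, 77, -96], ![20, 80, -103], ![21, 22, -43], ![24, 68, -92],
    ![26, 36, -62], ![29, 70, -99], ![30, 93, -123], ![34, 91, -122], ![35, 81, -116],
    ![39, 94, -133], ![41, 97, 128], ![42, 104, 120], ![46, 89, 131], ![47, 95, 124],
    ![49, 69, -118], ![51, 105, 110], ![52, 106, 111], ![53, 79, -132], ![54, 73, -127],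
    ![55, 100, 114], ![56, 101, 109], ![57, 102, 107], ![58, 83, 125], ![59, 78, 129],
    ![60, 98, 108], ![61, 82, 126], ![63, 76, 130], ![64, 84, 121], ![65, 86, 115],
    ![66, 87, 113], ![67, 90, 112]]
  | 10 => [![2, 46, -48], ![4, 21, -25], ![5, 87, -92], ![7, 74, -81], ![8, 20, -31], ![10, 75, -85],
    ![11, 16, -27], ![12, 90, -102], ![13, 84, -97], ![14, 77, -94], ![15, 23, -38],
    ![17, 19, -36], ![18, 29, -47], ![22, 33, -55], ![24, 30, -54], ![26, 73, -99],
    ![28, 68, -96], ![32, 91, -123], ![34, 120, 127], ![35, 70, -105], ![37, 104, 137],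
    ![39, 86, -125], ![40, 71, -111], ![41, 118, 119], ![42, 109, 130], ![43, 89, -132],
    ![44, 82, -126], ![45, 95, 138], ![49, 113, 116], ![50, 72, -122], ![51, 78, -129],
    ![52, 98, 128], ![53, 83, -139], ![56, 107, 115], ![57, 100, 124], ![58, 106, 117],
    ![59, 76, -135], ![60, 88, 133], ![61, 108, 112], ![62, 69, -131], ![63, 101, 114],
    ![64, 80, 134], ![65, 103, 110], ![66, 79, 136], ![67, 93, 121]]
  | 11 => [![2, 82, -84], ![4, 77, -81], ![5, 83, -91], ![7, 76, -80], ![8, 74, -85], ![10, 109, -116],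
    ![11, 16, -27], ![12, 78, -90], ![13, 25, -35], ![14, 75, -89], ![15, 28, -43],
    ![17, 69, -86], ![18, 70, -88], ![19, 21, -40], ![20, 34, -54], ![22, 26, -48],
    ![23, 24, -47], ![29, 95, -127], ![30, 32, -62], ![31, 98, -129], ![33, 68, -101],
    ![36, 96, -132], ![37, 107, -144], ![38, 113, 139], ![39, 94, -133], ![41, 119, 130],
    ![42, 105, 143], ![44, 97, -141], ![45, 106, 142], ![46, 104, 140], ![49, 87, -136],
    ![50, 73, -123], ![51, 71, -122], ![52, 93, -145], ![53, 111, 126], ![55, 103, 135],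
    ![56, 100, 134], ![57, 112, 124], ![58, 115, 120], ![59, 79, -138], ![60, 102, 128],
    ![61, 114, 118], ![63, 110, 117], ![64, 108, 121], ![65, 72, -137], ![66, 99, 125],
    ![67, 92, 131]]
  | 12 => [![2, 110, -115], ![4, 150, 151], ![5, 91, -96], ![7, 92, -99], ![8, 30, -38], ![10, 22, -29],
    ![11, 74, -88], ![12, 81, -93], ![13, 23, -36], ![14, 18, -32], ![15, 80, -95],
    ![16, 131, -147], ![17, 83, -103], ![19, 85, -101], ![20, 27, -47], ![21, 41, -62],
    ![24, 76, -100], ![25, 39, -64], ![26, 68, -97], ![28, 86, -114], ![31, 71, -102],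
    ![33, 87, -120], ![34, 107, -141], ![35, 104, -142], ![37, 106, -140], ![40, 117, 148],
    ![42, 90, -132], ![43, 75, -118], ![44, 79, -123], ![45, 108, 149], ![46, 113, 143],
    ![48, 119, 135], ![49, 78, -127], ![50, 72, -122], ![51, 105, 146], ![52, 84, -136],
    ![53, 89, -145], ![54, 70, -124], ![55, 121, 129], ![56, 112, 134], ![57, 73, -130],
    ![58, 82, -137], ![59, 69, -128], ![60, 116, 126], ![61, 77, -138], ![63, 109, 133],
    ![65, 98, 139], ![66, 111, 125], ![67, 94, 144]]
  | 13 => [![2, 112, -114], ![4, 94, -95], ![5, 81, -86], ![7, 122, -129], ![8, 104, -115],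
    ![10, 74, -84], ![11, 83, -97], ![12, 28, -40], ![13, 75, -88], ![14, 29, -46],
    ![15, 33, -48], ![16, 34, -47], ![17, 146, 151], ![18, 21, -39], ![19, 73, -89],
    ![20, 76, -96], ![22, 31, -50], ![23, 135, 156], ![24, 85, -109], ![25, 92, -117],
    ![26, 71, -100], ![27, 133, 157], ![30, 68, -98], ![32, 69, -101], ![35, 72, -107],
    ![36, 106, -142], ![37, 110, -147], ![38, 70, -108], ![41, 102, -143], ![42, 78, -120],
    ![43, 124, 150], ![44, 87, -131], ![45, 93, -138], ![49, 105, -154], ![51, 77, -128],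
    ![52, 103, -152], ![53, 121, 140], ![54, 82, -136], ![55, 130, 132], ![56, 113, 145],
    ![57, 116, 141], ![58, 111, 148], ![59, 118, 137], ![60, 79, -139], ![61, 119, 134],
    ![62, 91, -153], ![63, 125, 126], ![64, 80, -144], ![65, 90, -155], ![66, 99, 149],
    ![67, 123, 127]]
  | 14 => [![2, 75, -77], ![4, 74, -78], ![5, 100, -105], ![7, 90, -97], ![8, 72, -80], ![10, 69, -79],
    ![11, 99, -110], ![12, 45, -57], ![13, 23, -36], ![14, 68, -85], ![15, 93, -108],
    ![16, 70, -83], ![17, 27, -44], ![18, 106, -124], ![19, 31, -47], ![20, 137, -160],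
    ![21, 114, -135], ![22, 37, -56], ![24, 112, -136], ![25, 73, -95], ![26, 116, -145],
    ![28, 118, -143], ![29, 96, -125], ![30, 109, -139], ![32, 122, -157], ![33, 123, -156],
    ![34, 115, -146], ![35, 132, 159], ![38, 81, -119], ![39, 91, -130], ![40, 76, -113],
    ![41, 89, -133], ![42, 120, -162], ![43, 94, -134], ![46, 92, -138], ![48, 126, 152],
    ![49, 82, -128], ![50, 98, -151], ![51, 102, -153], ![52, 129, 148], ![53, 87, -140],
    ![54, 107, -161], ![55, 103, -155], ![58, 84, -142], ![59, 104, 163], ![60, 71, -131],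
    ![61, 127, 141], ![62, 117, 147], ![63, 86, -149], ![64, 121, 144], ![65, 111, 150],
    ![66, 88, -154], ![67, 101, 158]]
  | 15 => [![2, 80, -85], ![4, 107, -111], ![5, 35, -43], ![7, 73, -77], ![8, 126, -134], ![10, 16, -23],
    ![11, 70, -81], ![12, 109, -121], ![13, 160, 168], ![14, 69, -83], ![15, 142, -157],
    ![17, 25, -42], ![18, 94, -112], ![19, 120, -139], ![20, 82, -102], ![21, 74, -95],
    ![22, 34, -53], ![24, 86, -110], ![26, 72, -98], ![27, 78, -105], ![28, 79, -104],
    ![29, 87, -116], ![30, 99, -129], ![31, 91, -119], ![32, 68, -103], ![33, 90, -123],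
    ![36, 141, 161], ![37, 150, 154], ![38, 97, -135], ![39, 88, -127], ![40, 143, 155],
    ![41, 122, -166], ![44, 101, -148], ![45, 114, -159], ![46, 115, -158], ![47, 113, -163],
    ![48, 124, 169], ![49, 100, -146], ![50, 117, -167], ![51, 96, -147], ![52, 93, -145],
    ![54, 71, -125], ![55, 76, -128], ![56, 131, 151], ![57, 75, -132], ![58, 130, 153],
    ![59, 106, -165], ![60, 92, -152], ![61, 118, 162], ![62, 136, 140], ![63, 137, 138],
    ![64, 133, 144], ![65, 84, -149], ![66, 108, 164], ![67, 89, -156]]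
  | 16 => [![2, 143, -148], ![4, 90, -94], ![5, 106, -111], ![7, 109, -113], ![8, 53, -64],
    ![10, 51, -61], ![11, 16, -27], ![12, 169, 172], ![13, 69, -82], ![14, 81, -95],
    ![15, 70, -85], ![17, 105, -122], ![18, 144, -162], ![19, 164, 167], ![20, 74, -97],
    ![21, 153, -174], ![22, 71, -93], ![23, 137, -163], ![24, 92, -116], ![25, 101, -126],
    ![26, 76, -102], ![28, 73, -98], ![29, 75, -104], ![30, 78, -108], ![31, 83, -114],
    ![32, 91, -123], ![33, 86, -119], ![34, 100, -131], ![35, 72, -107], ![36, 99, -135],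
    ![37, 129, -166], ![38, 103, -141], ![39, 88, -127], ![40, 124, -161], ![41, 118, -159],
    ![42, 68, -110], ![43, 89, -132], ![44, 112, -156], ![45, 128, -173], ![46, 147, 160],
    ![47, 121, -168], ![48, 117, -165], ![49, 79, -125], ![50, 120, -170], ![52, 130, 171],
    ![54, 84, -138], ![55, 146, 149], ![56, 96, -152], ![57, 139, 157], ![58, 134, 158],
    ![59, 80, -142], ![60, 140, 150], ![62, 133, 155], ![63, 115, 175], ![65, 77, -145],
    ![66, 136, 151], ![67, 87, -154]]
  | _ => [![2, 158, -163], ![4, 114, -118], ![5, 115, -120], ![7, 146, -153], ![8, 74, -85],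
    ![10, 70, -77], ![11, 165, -176], ![12, 78, -90], ![13, 174, 178], ![14, 48, -62],
    ![15, 71, -86], ![16, 68, -84], ![17, 102, -119], ![18, 111, -129], ![19, 75, -94],
    ![20, 121, -141], ![21, 76, -97], ![22, 171, 172], ![23, 73, -96], ![24, 30, -54],
    ![25, 99, -124], ![26, 83, -112], ![27, 82, -109], ![28, 107, -135], ![29, 87, -116],
    ![31, 106, -134], ![32, 95, -130], ![33, 89, -122], ![34, 105, -139], ![35, 69, -104],
    ![36, 125, -161], ![37, 144, -181], ![38, 117, -155], ![39, 88, -127], ![40, 128, -168],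
    ![41, 72, -113], ![42, 147, 173], ![43, 93, -136], ![44, 98, -145], ![45, 103, -148],
    ![46, 150, 169], ![47, 79, -126], ![49, 91, -137], ![50, 132, 180], ![51, 149, 162],
    ![52, 154, 159], ![53, 143, 166], ![55, 133, 177], ![56, 123, -179], ![57, 100, -157],
    ![58, 80, -138], ![59, 151, 152], ![60, 110, -170], ![61, 81, -142], ![63, 101, -164],
    ![64, 131, 167], ![65, 92, -160], ![66, 140, 156], ![67, 108, -175]]

theorem tables_length (k : Fin 18) : (![3, 6, -9] :: tables k).length = 26 + 2 * (k : ℕ) := by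
  revert k
  decide

theorem tables_rowGood (k : Fin 18) : ∀ z ∈ ![3, 6, -9] :: tables k, RowGood (26 + 2 * k) z := by
  revert k
  decide +kernel

theorem tables_nodup (k : Fin 18) : ((![3, 6, -9] :: tables k).flatMap rowAbs).Nodup := by
  refine (nodup_of_distinctFrom (mask := 0) ?_).1
  revert k
  decide +kernel

end Tables

section Inflation

variable {ι : Type*} {n₀ m : ℕ}

/-- Sign switching. -/
def flip {G : Type*} [Neg G] (b : Bool) (g : G) : G := if b then g else -g

/-- The row inflated from row `j` of `Y` in position `o` of the array `k`. -/
def inflate (Y : ι → Fin 3 → ℤ × ZMod 3) (k : Fin 128) (j : ι) (o : Fin 9) (r : Fin 3) :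
    ℤ × ZMod 3 :=
  (9 * (Y j r).1 + arr k o r, (Y j r).2)

/-- A table followed by nine signed inflated rows for each row of `Y`. -/
def assemble (L : List (Fin 3 → ℤ)) (m : ℕ) (Y : ι → Fin 3 → ℤ × ZMod 3)
    (ω : ι → Fin 128 × (Fin 9 → Bool)) : Fin L.length ⊕ (ι × Fin 9) → Fin 3 → ℤ × ZMod 3 :=
  Sum.elim (fun i r => elt (9 * m) (L[i] r))
    (fun p r => flip ((ω p.1).2 p.2) (inflate Y (ω p.1).1 p.1 p.2 r))

theorem flip_fst_abs (b : Bool) (g : ℤ × ZMod 3) : |(flip b g).1| = |g.1| := by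
  cases b <;> simp [flip]

theorem eq_or_eq_neg_of_flip {b b' : Bool} {g h : ℤ × ZMod 3}
    (e : flip b g = flip b' h ∨ flip b g = -flip b' h) : g = h ∨ g = -h := by
  cases b <;> cases b' <;> simp [flip, neg_eq_iff_eq_neg] at e ⊢ <;> tauto

/-- A family of zero-sum triples with distinct entries, up to sign, among the `(x, c)` with
`2 < |x| ≤ m + 2`. -/
structure IsBase (m : ℕ) (Y : ι → Fin 3 → ℤ × ZMod 3) : Prop where
  sum : ∀ j, Y j 0 + Y j 1 + Y j 2 = 0
  lt : ∀ j r, 2 < |(Y j r).1|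
  le : ∀ j r, |(Y j r).1| ≤ m + 2
  inj : SignInj Y

variable {Y : ι → Fin 3 → ℤ × ZMod 3}

theorem IsBase.inflate_lt (hY : IsBase m Y) (k : Fin 128) (j : ι) (o : Fin 9) (r : Fin 3) :
    22 < |(inflate Y k j o r).1| := by
  have h1 := hY.lt j r
  have h2 := arr_le k o r
  simp only [inflate]
  rw [lt_abs] at h1 ⊢
  omega

theorem IsBase.inflate_le (hY : IsBase m Y) (k : Fin 128) (j : ι) (o : Fin 9) (r : Fin 3) :
    |(inflate Y k j o r).1| ≤ 22 + 9 * m := by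
  have h1 := hY.le j r
  have h2 := arr_le k o r
  simp only [inflate]
  rw [abs_le] at h1 ⊢
  omega

theorem IsBase.inflate_sum (hY : IsBase m Y) (k : Fin 128) (j : ι) (o : Fin 9) :
    inflate Y k j o 0 + inflate Y k j o 1 + inflate Y k j o 2 = 0 := by
  have h1 := congrArg Prod.fst (hY.sum j)
  have h2 := congrArg Prod.snd (hY.sum j)
  have h3 := arr_sum k o
  simp only [Prod.fst_add, Prod.fst_zero] at h1
  refine Prod.ext ?_ h2
  simp only [inflate, Prod.fst_add, Prod.fst_zero]
  linear_combination 9 * h1 + h3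

theorem IsBase.inflate_eq (hY : IsBase m Y) {k k' : Fin 128} {j j' : ι} {o o' : Fin 9}
    {r r' : Fin 3} (h : inflate Y k j o r = inflate Y k' j' o' r') :
    j = j' ∧ r = r' ∧ arr k o r = arr k' o' r' := by
  have h1 := arr_le k o r
  have h2 := arr_le k' o' r'
  have h3 := congrArg Prod.fst h
  have h4 : (Y j r).2 = (Y j' r').2 := (congrArg Prod.snd h :)
  simp only [inflate] at h3
  obtain ⟨rfl, rfl⟩ := hY.inj j r j' r' (.inl (Prod.ext (by omega) h4))
  exact ⟨rfl, rfl, by omega⟩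

theorem IsBase.inflate_ne_neg (hY : IsBase m Y) {k k' : Fin 128} {j j' : ι} {o o' : Fin 9}
    {r r' : Fin 3} : inflate Y k j o r ≠ -inflate Y k' j' o' r' := by
  intro h
  have h1 := arr_le k o r
  have h2 := arr_le k' o' r'
  have h3 : 9 * (Y j r).1 + arr k o r = -(9 * (Y j' r').1 + arr k' o' r') := congrArg Prod.fst h
  have h4 : (Y j r).2 = -(Y j' r').2 := congrArg Prod.snd h
  obtain ⟨rfl, rfl⟩ := hY.inj j r j' r' (.inr (Prod.ext (by simp; omega) h4))
  have := hY.lt j r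
  rw [lt_abs] at this
  omega

variable {L : List (Fin 3 → ℤ)}

theorem signInj_assemble (hd : (L.flatMap rowAbs).Nodup) (hY : IsBase m Y) (ω : ι → Fin 128 × (Fin 9 → Bool)) :
    SignInj (assemble L m Y ω) := by
  have hfar : ∀ i p r s, |(assemble L m Y ω (.inl i) r).1| ≠ |(assemble L m Y ω (.inr p) s).1| := by
    rintro i ⟨j, o⟩ r s h
    have h1 := hY.inflate_lt (ω j).1 j o s
    have h2 := hY.inflate_le (ω j).1 j o s
    simp only [assemble, Sum.elim_inl, Sum.elim_inr, flip_fst_abs] at h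
    rw [← h] at h1 h2
    simp only [elt, farSign] at h1 h2
    rw [lt_abs] at h1
    rw [abs_le] at h2
    split_ifs at h1 h2 <;> omega
  rintro (i | ⟨j, o⟩) r (i' | ⟨j', o'⟩) r' h
  · obtain ⟨rfl, rfl⟩ := entries_inj hd (natAbs_eq_of_elt (by positivity) h)
    exact ⟨rfl, rfl⟩
  · refine absurd ?_ (hfar i (j', o') r r')
    rcases h with h | h
    · rw [h]
    · rw [h, Prod.fst_neg, abs_neg]
  · refine absurd ?_ (hfar i' (j, o) r' r)
    rcases h with h | h
    · rw [h]
    · rw [h, Prod.fst_neg, abs_neg]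
  · rcases eq_or_eq_neg_of_flip h with h | h
    · obtain ⟨rfl, rfl, h⟩ := hY.inflate_eq h
      have ho : o = o' := arr_inj _ _ h
      subst ho
      exact ⟨rfl, rfl⟩
    · exact absurd h hY.inflate_ne_neg

theorem assemble_pos (hL : ∀ z ∈ L, RowGood n₀ z) (hY : IsBase m Y)
    (ω : ι → Fin 128 × (Fin 9 → Bool)) (i) (r : Fin 3) : 0 < |(assemble L m Y ω i r).1| := by
  rcases i with i | ⟨j, o⟩
  · have h := ((hL _ (List.getElem_mem i.2)).1 r).1
    rw [abs_pos]
    change ((L[i] r + 1) / 3).natAbs ≠ 0 at h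
    simp only [assemble, Sum.elim_inl, elt, farSign]
    split_ifs <;> omega
  · have := hY.inflate_lt (ω j).1 j o r
    simp only [assemble, Sum.elim_inr, flip_fst_abs]
    omega

theorem assemble_le (hn : 22 ≤ n₀) (hL : ∀ z ∈ L, RowGood n₀ z) (hY : IsBase m Y)
    (ω : ι → Fin 128 × (Fin 9 → Bool)) (i) (r : Fin 3) :
    |(assemble L m Y ω i r).1| ≤ (n₀ + 9 * m : ℕ) := by
  rcases i with i | ⟨j, o⟩
  · have h := ((hL _ (List.getElem_mem i.2)).1 r).2
    change ((L[i] r + 1) / 3).natAbs ≤ n₀ at h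
    rw [abs_le]
    simp only [assemble, Sum.elim_inl, elt, farSign]
    split_ifs <;> omega
  · have := hY.inflate_le (ω j).1 j o r
    simp only [assemble, Sum.elim_inr, flip_fst_abs]
    omega

theorem assemble_sum (hL : ∀ z ∈ L, RowGood n₀ z) (hY : IsBase m Y)
    (ω : ι → Fin 128 × (Fin 9 → Bool)) (i) :
    proj (n₀ + 9 * m)
      (assemble L m Y ω i 0 + assemble L m Y ω i 1 + assemble L m Y ω i 2) = 0 := by
  rcases i with i | ⟨j, o⟩
  · obtain ⟨-, τ, -, h1, h2, h3⟩ := hL _ (List.getElem_mem i.2)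
    rw [← proj_wrap (n₀ + 9 * m) τ]
    congr 1
    refine Prod.ext ?_ ?_
    · simp only [assemble, Sum.elim_inl, elt, Prod.fst_add, Fin.getElem_fin]
      push_cast
      linear_combination h2 + 9 * m * h1
    · simp only [assemble, Sum.elim_inl, elt, Prod.snd_add, Fin.getElem_fin]
      have h3 := (ZMod.intCast_zmod_eq_zero_iff_dvd _ 3).2 h3
      push_cast at h3
      linear_combination h3
  · have h := hY.inflate_sum (ω j).1 j o
    simp only [assemble, Sum.elim_inr]
    cases (ω j).2 o
    · simp only [flip, Bool.false_eq_true, if_false, ← neg_add, h, neg_zero, map_zero]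
    · simp only [flip, if_true, h, map_zero]

theorem card_le_NC_of_isBase [Fintype ι] (hι : Fintype.card ι = m) (hn : 22 ≤ n₀)
    (hlen : (![3, 6, -9] :: L).length = n₀) (hL : ∀ z ∈ ![3, 6, -9] :: L, RowGood n₀ z)
    (hd : ((![3, 6, -9] :: L).flatMap rowAbs).Nodup) (hY : IsBase m Y) :
    (2 ^ 16) ^ m ≤ NC (6 * (n₀ + 9 * m) + 3) 3 * (6 * (n₀ + 9 * m) + 3) ^ 3 := by
  classical
  set n := n₀ + 9 * m with hndef
  let X := fun ω : ι → Fin 128 × (Fin 9 → Bool) => assemble (![3, 6, -9] :: L) m Y ω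
  have hT : ∀ ω, ∃ T : ZMod (6 * n + 3) → ZMod (6 * n + 3), IsThirdPoint T ∧
      (∀ i r, T (proj n (X ω i r)) = proj n (-X ω i (r - 1))) ∧
      ∀ i r, T (proj n (-X ω i r)) = proj n (X ω i (r + 1)) := fun ω =>
    exists_isThirdPoint_of_signInj (by simp [hndef, ← hlen, hι, mul_comm]) (X ω)
      (signInj_assemble hd hY ω) (assemble_pos hL hY ω) (assemble_le hn hL hY ω)
      (assemble_sum hL hY ω)
  choose T hT hTpos hTneg using hT
  have hcast : ∀ k : ℕ, 0 < k → k < 6 * n + 3 → (k : ZMod (6 * n + 3)) ≠ 0 := by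
    intro k h0 h1 h
    rw [ZMod.natCast_eq_zero_iff] at h
    exact absurd (Nat.le_of_dvd h0 h) (by omega)
  have hcard : Fintype.card (ι → Fin 128 × (Fin 9 → Bool)) = (2 ^ 16) ^ m := by
    rw [Fintype.card_fun, hι]
    norm_num
  rw [← hcard]
  refine card_le_NC (by simpa using hcast 1 (by omega) (by omega))
    (by simpa using hcast 2 (by omega) (by omega)) (by simpa using hcast 3 (by omega) (by omega))
    T hT ?_ ?_
  · intro ω
    have h := hTpos ω (.inl 0) 0
    have h1 : X ω (.inl 0) 0 = (1, ((0 : ℤ) : ZMod 3)) := by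
      change elt (9 * m) 3 = _
      simp [elt, farSign]
      rfl
    have h2 : -X ω (.inl 0) (0 - 1) = (3, ((0 : ℤ) : ZMod 3)) := by
      change -elt (9 * m) (-9) = _
      rw [← elt_neg]
      simp [elt, farSign]
      rfl
    rw [h1, h2, proj_apply, proj_apply] at h
    simpa using h
  · intro ω ω' h
    have hval : ∀ ω j o, T ω (proj n (inflate Y 0 j o 0)) =
        proj n (-inflate Y (ω j).1 j o (if (ω j).2 o then 2 else 1)) := by
      intro ω j o
      have e0 : inflate Y 0 j o 0 = inflate Y (ω j).1 j o 0 := rfl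
      have hp := hTpos ω (.inr (j, o)) 0
      have hq := hTneg ω (.inr (j, o)) 0
      simp only [X, assemble, Sum.elim_inr, flip] at hp hq
      rw [e0]
      cases hb : (ω j).2 o
      · simpa [hb] using hq
      · simpa [hb, show (-1 : Fin 3) = 2 from rfl] using hp
    have hle : ∀ k j o r, |(inflate Y k j o r).1| ≤ n := by
      intro k j o r
      have := hY.inflate_le k j o r
      omega
    have hkey : ∀ j o, (if (ω j).2 o then (2 : Fin 3) else 1) = (if (ω' j).2 o then 2 else 1) ∧
        arr (ω j).1 o (if (ω j).2 o then 2 else 1) =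
          arr (ω' j).1 o (if (ω' j).2 o then 2 else 1) := by
      intro j o
      have h1 := h (proj n (inflate Y 0 j o 0)) (by
        intro h0
        have := proj_inj (hle _ _ _ _) (by simp) (h0.trans (map_zero _).symm)
        have h2 := hY.inflate_lt 0 j o 0
        rw [this] at h2
        simp at h2)
      rw [hval, hval, map_neg, map_neg, neg_inj] at h1
      exact (hY.inflate_eq (proj_inj (hle _ _ _ _) (hle _ _ _ _) h1)).2
    funext j
    refine Prod.ext (arr_ext fun o => ?_) (funext fun o => ?_)
    · obtain ⟨h1, h2⟩ := hkey j o
      have h3 := arr_sum (ω j).1 o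
      have h4 := arr_sum (ω' j).1 o
      have h5 : arr (ω j).1 o 0 = arr (ω' j).1 o 0 := rfl
      rw [← h1] at h2
      split_ifs at h2
      · linarith
      · exact h2
    · have h1 := (hkey j o).1
      cases hb : (ω j).2 o <;> cases hb' : (ω' j).2 o <;> simp [hb, hb'] at h1 ⊢

end Inflation

section Base

/-- The long families of rows `(d, a, -b)` with `b - a = d`, encoded by `3 d`, `3 a + 1`,
`-(3 b + 1)`. -/
def strip (M : ℕ) (s : Fin 4) (i : ℕ) : Fin 3 → ℤ :=
  match s with
  | 0 => ![6 * (i + 3), 3 * (-2 * M - (i + 3)) + 1, -(3 * (-2 * M + (i + 3)) + 1)]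
  | 1 => ![6 * (M + i + 3) + 3, 3 * (-2 * M - 1 - (M + i + 3)) + 1,
      -(3 * (-2 * M + (M + i + 3)) + 1)]
  | 2 => ![6 * (i + 3) + 3, 3 * (2 * M + 1 - (i + 3)) + 1, -(3 * (2 * M + 2 + (i + 3)) + 1)]
  | 3 => ![6 * (M + i + 3), 3 * (2 * M - (M + i + 3)) + 1, -(3 * (2 * M + (M + i + 3)) + 1)]

/-- The remaining rows; a pair `(α, β)` stands for `3 M α + β`. -/
def coreRows (c : Fin 2) : List (Fin 3 → ℤ × ℤ) :=
  match c with
  | 0 => [![(0, 9), (2, 1), (-2, -10)], ![(0, 12), (2, 0), (-2, -12)], ![(0, 15), (4, -12), (-4, -3)],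
   ![(2, -12), (2, 7), (-4, 5)], ![(2, -9), (2, 13), (-4, -4)], ![(2, -6), (2, 6), (-4, 0)],
   ![(2, -3), (-4, 4), (2, -1)], ![(2, 3), (-4, 1), (2, -4)], ![(2, 9), (-3, -5), (1, -4)],
   ![(2, 15), (-1, -10), (-1, -5)], ![(4, -9), (-1, 2), (-3, 7)], ![(4, -6), (-3, -1), (-1, 7)],
   ![(4, -3), (-1, 5), (-3, -2)], ![(1, 1), (3, 4), (-4, -2)], ![(1, 4), (2, -2), (-3, 1)],
   ![(1, 7), (2, 4), (-3, -8)], ![(3, 7), (-2, -2), (-1, -2)], ![(4, -2), (-3, 4), (-1, 1)],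
   ![(4, 1), (-2, -5), (-2, 7)]]
  | 1 => [![(0, 9), (4, -2), (-4, -7)], ![(0, 12), (4, -12), (-4, 0)], ![(0, 15), (2, -2), (-2, -13)],
   ![(2, -12), (2, 9), (-4, 3)], ![(2, -9), (2, 0), (-4, 9)], ![(2, -6), (-4, 4), (2, 2)],
   ![(2, -3), (2, 6), (-4, -3)], ![(2, 3), (-3, 1), (1, -4)], ![(2, 12), (-4, -5), (2, -7)],
   ![(2, 15), (-1, -10), (-1, -5)], ![(4, -6), (-3, -1), (-1, 7)], ![(4, 6), (-2, -7), (-2, 1)],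
   ![(1, -5), (3, 7), (-4, 1)], ![(1, -2), (2, 10), (-3, -5)], ![(1, 1), (3, 4), (-4, -2)],
   ![(1, 4), (2, 1), (-3, -2)], ![(1, 7), (2, 4), (-3, -8)], ![(4, -5), (-3, 7), (-1, 1)],
   ![(4, 1), (-3, 4), (-1, -2)], ![(4, 4), (-2, -5), (-2, 4)]]

/-- The normalised pairs `(α, β)` for which `3 M α + β` is not an entry of a strip. -/
def IsCore (c : Fin 2) (p : ℤ × ℤ) : Prop :=
  (p.2 % 3 = 1 ∧
    (p.1 = -4 ∧ -2 - 3 * (c : ℕ) ≤ p.2 ∧ p.2 ≤ 4 ∨ p.1 = -3 ∧ -8 ≤ p.2 ∧ p.2 ≤ 7 ∨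
      p.1 = -2 ∧ -5 ≤ p.2 ∧ p.2 ≤ 7 ∨ p.1 = -1 ∧ -5 ≤ p.2 ∧ p.2 ≤ 7 ∨
      p.1 = 1 ∧ -5 ≤ p.2 ∧ p.2 ≤ 10 ∨ p.1 = 2 ∧ -2 ≤ p.2 ∧ p.2 ≤ 13 ∨
      p.1 = 3 ∧ 1 ≤ p.2 ∧ p.2 ≤ 7 ∨ p.1 = 4 ∧ -5 ≤ p.2 ∧ p.2 ≤ 4 + 3 * (c : ℕ))) ∨
  (p.2 % 3 = 0 ∧
    (p.1 = 0 ∧ 9 ≤ p.2 ∧ p.2 ≤ 15 ∨ p.1 = 2 ∧ -12 ≤ p.2 ∧ p.2 ≤ 15 ∨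
      p.1 = 4 ∧ -12 ≤ p.2 ∧ p.2 ≤ 3 + 3 * (c : ℕ)))

instance (c : Fin 2) (p : ℤ × ℤ) : Decidable (IsCore c p) := by
  unfold IsCore
  infer_instance

theorem coreRows_length (c : Fin 2) : (coreRows c).length = 19 + c := by
  revert c
  decide

theorem coreRows_good (c : Fin 2) : ∀ z ∈ coreRows c,
    (∀ r, IsCore c (z r) ∨ IsCore c (-z r)) ∧
    (∀ r s, z r = z s ∨ z r = -z s → r = s) ∧
    (z 0).1 + (z 1).1 + (z 2).1 = 0 ∧
    ((z 0).2 + 1) / 3 + ((z 1).2 + 1) / 3 + ((z 2).2 + 1) / 3 = 0 ∧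
    3 ∣ (z 0).2 + (z 1).2 + (z 2).2 := by
  revert c
  decide +kernel

theorem coreRows_pairwise (c : Fin 2) :
    (coreRows c).Pairwise fun z z' => ∀ r s, z r ≠ z' s ∧ z r ≠ -z' s := by
  revert c
  decide +kernel

/-- The integer `3 M α + β`. -/
def coreVal (M : ℕ) (p : ℤ × ℤ) : ℤ := 3 * M * p.1 + p.2

theorem coreVal_neg (M : ℕ) (p : ℤ × ℤ) : coreVal M (-p) = -coreVal M p := by
  simp only [coreVal, Prod.fst_neg, Prod.snd_neg]
  ring

variable {M : ℕ} {c : Fin 2}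

theorem coreVal_inj (hM : 20 ≤ M) {p q : ℤ × ℤ} (hp : |p.2| ≤ 16) (hq : |q.2| ≤ 16)
    (h : coreVal M p = coreVal M q) : p = q := by
  have h0 : p.2 - q.2 = 0 := by
    refine Int.eq_zero_of_abs_lt_dvd (m := 3 * M) ⟨q.1 - p.1, ?_⟩ ?_
    · simp only [coreVal] at h
      linear_combination h
    · rw [abs_le] at hp hq
      rw [abs_lt]
      omega
  have h1 : (3 * M : ℤ) * (p.1 - q.1) = 0 := by
    simp only [coreVal] at h
    linear_combination h - h0
  rcases mul_eq_zero.1 h1 with h1 | h1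
  · omega
  · exact Prod.ext (by omega) (by omega)

theorem IsCore.abs_le {p : ℤ × ℤ} (h : IsCore c p) : |p.2| ≤ 16 := by
  have := c.2
  rw [_root_.abs_le]
  simp only [IsCore] at h
  omega

theorem abs_le_of_core {p : ℤ × ℤ} (h : IsCore c p ∨ IsCore c (-p)) : |p.2| ≤ 16 := by
  rcases h with h | h
  · exact h.abs_le
  · simpa using h.abs_le

theorem IsCore.range (hM : 20 ≤ M) {p : ℤ × ℤ} (h : IsCore c p) :
    3 ≤ ((coreVal M p + 1) / 3).natAbs ∧
      ((coreVal M p + 1) / 3).natAbs ≤ 4 * M + 1 + (c : ℕ) := by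
  have := c.2
  obtain ⟨α, β⟩ := p
  simp only [IsCore, coreVal] at h ⊢
  rcases h with ⟨h0, h⟩ | ⟨h0, h⟩
  · rcases h with ⟨rfl, h⟩ | ⟨rfl, h⟩ | ⟨rfl, h⟩ | ⟨rfl, h⟩ | ⟨rfl, h⟩ | ⟨rfl, h⟩ | ⟨rfl, h⟩ |
      ⟨rfl, h⟩ <;> omega
  · rcases h with ⟨rfl, h⟩ | ⟨rfl, h⟩ | ⟨rfl, h⟩ <;> omega

theorem strip_range {i : ℕ} (s : Fin 4) (hi : i < M - 5) (r : Fin 3) :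
    3 ≤ ((strip M s i r + 1) / 3).natAbs ∧ ((strip M s i r + 1) / 3).natAbs ≤ 4 * M + 1 := by
  fin_cases s <;> fin_cases r <;> simp [strip] <;> omega

theorem strip_sum (s : Fin 4) (i : ℕ) :
    (strip M s i 0 + 1) / 3 + (strip M s i 1 + 1) / 3 + (strip M s i 2 + 1) / 3 = 0 ∧
      3 ∣ strip M s i 0 + strip M s i 1 + strip M s i 2 := by
  fin_cases s <;> simp [strip] <;> omega

theorem strip_inj {s s' : Fin 4} {i i' : ℕ} (hi : i < M - 5) (hi' : i' < M - 5) {r r' : Fin 3}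
    (h : (strip M s i r).natAbs = (strip M s' i' r').natAbs) : s = s' ∧ i = i' ∧ r = r' := by
  fin_cases s <;> fin_cases s' <;> fin_cases r <;> fin_cases r' <;> simp [strip] at h ⊢ <;> omega

theorem IsCore.ne_strip (hM : 20 ≤ M) {p : ℤ × ℤ} (hp : IsCore c p) {s : Fin 4} {i : ℕ}
    (hi : i < M - 5) (r : Fin 3) : (coreVal M p).natAbs ≠ (strip M s i r).natAbs := by
  obtain ⟨α, β⟩ := p
  simp only [IsCore, coreVal] at hp ⊢
  have := c.2
  intro h
  fin_cases s <;> fin_cases r <;> simp [strip] at h <;> rcases hp with ⟨h0, hp⟩ | ⟨h0, hp⟩ <;>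
    first
    | omega
    | rcases hp with ⟨rfl, hp⟩ | ⟨rfl, hp⟩ | ⟨rfl, hp⟩ | ⟨rfl, hp⟩ | ⟨rfl, hp⟩ | ⟨rfl, hp⟩ |
        ⟨rfl, hp⟩ | ⟨rfl, hp⟩ <;> omega

/-- The rows of the base family, as encoded integers. -/
def baseRow (M : ℕ) (c : Fin 2) : (Fin 4 × Fin (M - 5)) ⊕ Fin (coreRows c).length → Fin 3 → ℤ :=
  Sum.elim (fun p => strip M p.1 p.2) (fun i r => coreVal M ((coreRows c)[i] r))

theorem baseRow_range (hM : 20 ≤ M) (i) (r : Fin 3) :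
    3 ≤ ((baseRow M c i r + 1) / 3).natAbs ∧
      ((baseRow M c i r + 1) / 3).natAbs ≤ 4 * M + 1 + (c : ℕ) := by
  rcases i with ⟨s, i⟩ | i
  · have := strip_range s i.2 r
    exact ⟨this.1, by simp only [baseRow, Sum.elim_inl]; omega⟩
  · rcases (coreRows_good c _ (List.getElem_mem i.2)).1 r with h | h
    · exact h.range hM
    · have h := h.range hM
      rw [coreVal_neg] at h
      simp only [baseRow, Sum.elim_inr, Fin.getElem_fin]
      omega

theorem baseRow_sum (i) :
    (baseRow M c i 0 + 1) / 3 + (baseRow M c i 1 + 1) / 3 + (baseRow M c i 2 + 1) / 3 = 0 ∧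
      3 ∣ baseRow M c i 0 + baseRow M c i 1 + baseRow M c i 2 := by
  rcases i with ⟨s, i⟩ | i
  · exact strip_sum s i
  · obtain ⟨-, -, h1, h2, h3⟩ := coreRows_good c _ (List.getElem_mem i.2)
    have hdiv : ∀ p : ℤ × ℤ, (coreVal M p + 1) / 3 = M * p.1 + (p.2 + 1) / 3 := by
      intro p
      rw [coreVal, show 3 * M * p.1 + p.2 + 1 = p.2 + 1 + M * p.1 * 3 by ring,
        Int.add_mul_ediv_right _ _ (by norm_num)]
      ring
    simp only [baseRow, Sum.elim_inr, Fin.getElem_fin, hdiv]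
    refine ⟨by linear_combination M * h1 + h2, ?_⟩
    simp only [coreVal]
    obtain ⟨k, hk⟩ := h3
    exact ⟨k, by linear_combination 3 * M * h1 + hk⟩

theorem baseRow_inj (hM : 20 ≤ M) {i j} {r s : Fin 3}
    (h : (baseRow M c i r).natAbs = (baseRow M c j s).natAbs) : i = j ∧ r = s := by
  have hcore : ∀ (k : Fin (coreRows c).length) (r : Fin 3) {t : Fin 4} {l : ℕ}, l < M - 5 →
      ∀ r', (coreVal M ((coreRows c)[k] r)).natAbs ≠ (strip M t l r').natAbs := by
    intro k r t l hl r'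
    rcases (coreRows_good c _ (List.getElem_mem k.2)).1 r with h | h
    · exact h.ne_strip hM hl r'
    · have := h.ne_strip hM (s := t) hl r'
      rwa [coreVal_neg, Int.natAbs_neg] at this
  rcases i with ⟨t, i⟩ | i <;> rcases j with ⟨t', j⟩ | j
  · obtain ⟨rfl, h1, rfl⟩ := strip_inj i.2 j.2 h
    rw [Fin.ext h1]
    exact ⟨rfl, rfl⟩
  · exact absurd h.symm (hcore j s i.2 r)
  · exact absurd h (hcore i r j.2 s)
  · have hi := abs_le_of_core ((coreRows_good c _ (List.getElem_mem i.2)).1 r)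
    have hj := abs_le_of_core ((coreRows_good c _ (List.getElem_mem j.2)).1 s)
    have h : (coreRows c)[i] r = (coreRows c)[j] s ∨ (coreRows c)[i] r = -(coreRows c)[j] s := by
      rw [Int.natAbs_eq_natAbs_iff] at h
      refine h.imp (coreVal_inj hM hi hj) fun h => coreVal_inj hM hi (by simpa using hj) ?_
      rw [coreVal_neg]
      exact h
    have hpw := List.pairwise_iff_getElem.1 (coreRows_pairwise c)
    rcases lt_trichotomy i j with hlt | rfl | hlt
    · have := hpw i j i.2 j.2 hlt r s
      exact absurd h (by simpa using this)
    · exact ⟨rfl, (coreRows_good c _ (List.getElem_mem i.2)).2.1 r s h⟩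
    · have := hpw j i j.2 i.2 hlt s r
      rw [eq_comm, ← neg_eq_iff_eq_neg, eq_comm (a := -_)] at h
      exact absurd h (by simpa using this)

theorem isBase_baseRow (hM : 20 ≤ M) :
    IsBase (4 * M - 1 + c) (fun i r => elt 0 (baseRow M c i r)) := by
  refine ⟨fun i => ?_, fun i r => ?_, fun i r => ?_, fun i r j s h => ?_⟩
  · obtain ⟨h1, h2⟩ := baseRow_sum (M := M) (c := c) i
    have h2 := (ZMod.intCast_zmod_eq_zero_iff_dvd _ 3).2 h2
    push_cast at h2
    exact Prod.ext (by simpa [elt] using h1) h2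
  · have := (baseRow_range (c := c) hM i r).1
    simp only [elt, zero_mul, add_zero, lt_abs]
    omega
  · have := (baseRow_range (c := c) hM i r).2
    simp only [elt, zero_mul, add_zero, abs_le]
    omega
  · exact baseRow_inj hM (natAbs_eq_of_elt le_rfl h)

theorem card_baseRow (hM : 20 ≤ M) :
    Fintype.card ((Fin 4 × Fin (M - 5)) ⊕ Fin (coreRows c).length) = 4 * M - 1 + c := by
  simp only [Fintype.card_sum, Fintype.card_prod, Fintype.card_fin, coreRows_length]
  omega

end Base

section Main

/-- The number of cyclic Steiner triple systems grows at least like `2 ^ (16 n / 9)`. -/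
theorem exists_pow_le_NC {n : ℕ} (hn : 1000 ≤ n) :
    ∃ m, n ≤ 60 + 9 * m ∧ 9 * m ≤ n ∧
      (2 ^ 16) ^ m ≤ NC (6 * n + 3) 3 * (6 * n + 3) ^ 3 := by
  obtain ⟨k, c, M, hM, h⟩ : ∃ (k : Fin 18) (c : Fin 2) (M : ℕ), 20 ≤ M ∧
      n = 26 + 2 * (k : ℕ) + 9 * (4 * M - 1 + c) := by
    rcases Nat.even_or_odd' n with ⟨q, rfl | rfl⟩
    · refine ⟨⟨(q - 13) % 18, Nat.mod_lt _ (by norm_num)⟩, 1, (q - 13) / 18, ?_, ?_⟩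
      · omega
      · simp only [Fin.val_one]
        omega
    · refine ⟨⟨(q - 26) % 18, Nat.mod_lt _ (by norm_num)⟩, 0, (q - 26) / 18 + 1, ?_, ?_⟩
      · omega
      · simp only [Fin.val_zero]
        omega
  refine ⟨4 * M - 1 + c, by omega, by omega, ?_⟩
  rw [h]
  exact card_le_NC_of_isBase (card_baseRow hM) (by omega) (tables_length k) (tables_rowGood k)
    (tables_nodup k) (isBase_baseRow hM)

theorem eventually_pow_le : ∀ᶠ m : ℕ in Filter.atTop,
    (3.35 : ℝ) ^ (60 + 9 * m) * (6 * (60 + 9 * m) + 3) ^ 3 ≤ (2 ^ 16) ^ m := by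
  have h := tendsto_pow_const_mul_const_pow_of_abs_lt_one 3
    (r := (3.35 : ℝ) ^ 9 / 2 ^ 16) (by rw [abs_of_pos (by positivity)]; norm_num)
  have hpos : (0 : ℝ) < 1 / (3.35 ^ 60 * 417 ^ 3) := by positivity
  filter_upwards [h.eventually_le_const hpos, Filter.eventually_ge_atTop 1] with m hm hm1
  have hm1 : (1 : ℝ) ≤ m := by exact_mod_cast hm1
  rw [div_pow, ← pow_mul, le_div_iff₀ (by positivity), ← mul_div_assoc, div_mul_eq_mul_div,
    div_le_one (by positivity)] at hm
  calc (3.35 : ℝ) ^ (60 + 9 * m) * (6 * (60 + 9 * (m : ℝ)) + 3) ^ 3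
      ≤ 3.35 ^ (60 + 9 * m) * (417 * (m : ℝ)) ^ 3 := by gcongr; linarith
    _ = (m : ℝ) ^ 3 * 3.35 ^ (9 * m) * (3.35 ^ 60 * 417 ^ 3) := by ring
    _ ≤ (2 ^ 16) ^ m := hm

end Main

end CCS

/-- For all sufficiently large `n ≡ 3, 5, 24, 26 (mod 28)`,
`NC(6n+3, 3) ≥ 3.35^n`. -/
theorem stmt4 : ∃ N : ℕ, ∀ n : ℕ, N ≤ n →
    (n % 28 = 3 ∨ n % 28 = 5 ∨ n % 28 = 24 ∨ n % 28 = 26) →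
    (3.35 : ℝ) ^ n ≤ (CCS.NC (6 * n + 3) 3 : ℝ) := by
  obtain ⟨m₀, hm₀⟩ := Filter.eventually_atTop.1 CCS.eventually_pow_le
  refine ⟨1000 + 9 * m₀ + 60, fun n hn _ => ?_⟩
  obtain ⟨m, h1, h2, h3⟩ := CCS.exists_pow_le_NC (n := n) (by omega)
  have h3 : ((2 : ℝ) ^ 16) ^ m ≤ CCS.NC (6 * n + 3) 3 * (6 * n + 3) ^ 3 := by exact_mod_cast h3
  have h1' : (n : ℝ) ≤ 60 + 9 * m := by exact_mod_cast h1
  refine le_of_mul_le_mul_right (a := ((6 * n + 3 : ℝ)) ^ 3) ?_ (by positivity)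
  calc (3.35 : ℝ) ^ n * (6 * n + 3) ^ 3
      ≤ 3.35 ^ (60 + 9 * m) * (6 * (60 + 9 * m) + 3) ^ 3 := by
        gcongr
        norm_num
    _ ≤ (2 ^ 16) ^ m := hm₀ m (by omega)
    _ ≤ _ := h3
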